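/- Let A ∈ ℝ^{m×n} with rank(A) = m, y ∈ ℝ^m, T ⊆ {1,…,n} with |T| ≤ m, λ > 0 and α > 0. Suppose the proximal alternating minimization sequence (u_k, v_k) started at (u₀, v₀) converges to a global minimizer (u*, v*) of g, and set z* = u*∘v*. Assume in addition: T ⊆ supp(z*); z* has at most m nonzero entries; and, with γ = Aᵀ(Az* − y), the strict complementarity condition holds: γ_j = 0 for j ∈ T, γ_j = −λ·sign(z*_j) for j ∈ T^c with z*_j ≠ 0, and |γ_j| < λ for j ∈ T^c with z*_j = 0. Then there exist c > 0, τ ∈ (0,1) and an integer k₀ such that for all k ≥ k₀, ‖(u_k, v_k) − (u*, v*)‖₂ ≤ c·τ^{k−k₀}; i.e., the iterates converge linearly. -/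

import Mathlib

open scoped BigOperators
open Matrix

/-- A vector is `k`-sparse if it has at most `k` nonzero entries. -/
def Sparse {n : ℕ} (k : ℕ) (x : Fin n → ℝ) : Prop :=
  ∃ S : Finset (Fin n), S.card ≤ k ∧ ∀ i ∉ S, x i = 0

/-- The Hadamard product parametrization objective, as a function of the pair `(u, v)`. -/
noncomputable def hppObj {m n : ℕ} (A : Matrix (Fin m) (Fin n) ℝ) (y : Fin m → ℝ)
    (T : Finset (Fin n)) (lam : ℝ) (p : (Fin n → ℝ) × (Fin n → ℝ)) : ℝ :=
  (∑ i, (A.mulVec (fun j => p.1 j * p.2 j) i - y i) ^ 2) / 2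
    + lam / 2 * ((∑ j ∈ Tᶜ, p.1 j ^ 2) + ∑ j ∈ Tᶜ, p.2 j ^ 2)

/-- The ℓ₂ norm of a pair of vectors. -/
noncomputable def pairl2norm {n : ℕ} (p : (Fin n → ℝ) × (Fin n → ℝ)) : ℝ :=
  Real.sqrt ((∑ i, p.1 i ^ 2) + ∑ i, p.2 i ^ 2)

section Aux
open Filter Topology Asymptotics

lemma aux_quad (b c : ℝ) (h : ∀ t : ℝ, 0 ≤ t * b + t ^ 2 * c) : b = 0 := by
  by_contra hb
  have hc : 0 < |c| + 1 := by positivity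
  have h1 := h (-b / (|c| + 1))
  have h2 : (-b / (|c| + 1)) * b + (-b / (|c| + 1)) ^ 2 * c
      = b ^ 2 / (|c| + 1) ^ 2 * (c - (|c| + 1)) := by
    field_simp
    ring
  rw [h2] at h1
  have h3 : 0 < b ^ 2 / (|c| + 1) ^ 2 := by positivity
  have h4 : c - (|c| + 1) < 0 := by linarith [le_abs_self c]
  nlinarith [mul_neg_of_pos_of_neg h3 h4]

lemma aux_sumsq {ι : Type*} (s : Finset ι) (a c : ι → ℝ) (t : ℝ) :
    ∑ i ∈ s, (a i + t * c i) ^ 2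
      = ∑ i ∈ s, a i ^ 2 + t * (2 * ∑ i ∈ s, a i * c i) + t ^ 2 * ∑ i ∈ s, c i ^ 2 := by
  simp only [Finset.mul_sum]
  rw [← Finset.sum_add_distrib, ← Finset.sum_add_distrib]
  exact Finset.sum_congr rfl fun i _ => by ring

lemma hpp_comm {m n : ℕ} (A : Matrix (Fin m) (Fin n) ℝ) (y : Fin m → ℝ)
    (T : Finset (Fin n)) (lam : ℝ) (x w : Fin n → ℝ) :
    hppObj A y T lam (x, w) = hppObj A y T lam (w, x) := by
  simp only [hppObj]
  have : (fun j => x j * w j) = fun j => w j * x j := by funext j; ring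
  rw [this]; ring

lemma hpp_stat {m n : ℕ} (A : Matrix (Fin m) (Fin n) ℝ) (y : Fin m → ℝ)
    (T : Finset (Fin n)) (lam α : ℝ) (hα : 0 < α) (x w x0 : Fin n → ℝ)
    (h : ∀ u' : Fin n → ℝ, hppObj A y T lam (x, w) + (∑ i, (x i - x0 i) ^ 2) / (2 * α)
        ≤ hppObj A y T lam (u', w) + (∑ i, (u' i - x0 i) ^ 2) / (2 * α)) (j : Fin n) :
    w j * (Aᵀ.mulVec (A.mulVec (fun i => x i * w i) - y)) j
      + (if j ∈ T then 0 else lam * x j) + (x j - x0 j) / α = 0 := by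
  set e : Fin n → ℝ := Pi.single j 1 with he
  set r : Fin m → ℝ := A.mulVec (fun i => x i * w i) - y with hr
  set c : Fin m → ℝ := A.mulVec (fun i => e i * w i) with hc
  have key := aux_quad
    ((∑ i, r i * c i) + lam * (∑ i ∈ Tᶜ, x i * e i) + (∑ i, (x i - x0 i) * e i) / α)
    ((∑ i, c i ^ 2) / 2 + lam / 2 * (∑ i ∈ Tᶜ, e i ^ 2) + (∑ i, e i ^ 2) / (2 * α)) (by
      intro t
      have h1 := h (fun i => x i + t * e i)
      simp only [hppObj] at h1
      have e1 : ∀ i, A.mulVec (fun j => (x j + t * e j) * w j) i - y i = r i + t * c i := by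
        intro i
        have : (fun j => (x j + t * e j) * w j)
            = (fun j => x j * w j) + t • (fun j => e j * w j) := by
          funext j; simp; ring
        rw [this, Matrix.mulVec_add, Matrix.mulVec_smul]
        simp [hr, hc]; ring
      have e2 : ∀ i, x i + t * e i - x0 i = (x i - x0 i) + t * e i := by intro i; ring
      have e3 : ∀ i, A.mulVec (fun j => x j * w j) i - y i = r i := by intro i; simp [hr]
      simp only [e1, e2, e3, aux_sumsq] at h1
      have hα' : α ≠ 0 := hα.ne'
      have : (∑ i, (x i - x0 i) ^ 2 + t * (2 * ∑ i, (x i - x0 i) * e i)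
          + t ^ 2 * ∑ i, e i ^ 2) / (2 * α) = (∑ i, (x i - x0 i) ^ 2) / (2 * α)
            + t * ((∑ i, (x i - x0 i) * e i) / α) + t ^ 2 * ((∑ i, e i ^ 2) / (2 * α)) := by
        field_simp
      rw [this] at h1
      linarith)
  have k1 : ∑ i, r i * c i = w j * (Aᵀ.mulVec r) j := by
    have : (fun i => e i * w i) = Pi.single j (w j) := by
      funext i
      by_cases hij : i = j
      · subst hij; simp [he]
      · simp [he, hij]
    simp only [hc, this, Matrix.mulVec, dotProduct, Matrix.transpose_apply, Finset.mul_sum]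
    refine Finset.sum_congr rfl fun i _ => ?_
    rw [Finset.sum_eq_single j]
    · simp; ring
    · intro b _ hb; simp [hb]
    · simp
  have k2 : ∑ i, (x i - x0 i) * e i = x j - x0 j := by
    simp [he, Pi.single_apply]
  have k3 : lam * (∑ i ∈ Tᶜ, x i * e i) = if j ∈ T then 0 else lam * x j := by
    by_cases hj : j ∈ T <;> simp [he, Pi.single_apply, hj]
  rw [k1, k2, k3] at key
  exact key

/-- a linear map is controlled by its Gram map -/
lemma aux_gram {m n : ℕ} (B : Matrix (Fin m) (Fin n) ℝ) :
    ∃ M : (Fin n → ℝ) →ₗ[ℝ] (Fin m → ℝ), ∀ x, B.mulVec x = M ((Bᵀ * B).mulVec x) := by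
  have hk : LinearMap.ker (Bᵀ * B).mulVecLin ≤ LinearMap.ker B.mulVecLin := by
    rw [Matrix.ker_mulVecLin_transpose_mul_self]
  obtain ⟨M, hM⟩ := LinearMap.exists_extend
    (((LinearMap.ker (Bᵀ * B).mulVecLin).liftQ B.mulVecLin hk).comp
      (Bᵀ * B).mulVecLin.quotKerEquivRange.symm.toLinearMap)
  refine ⟨M, fun x => ?_⟩
  have := LinearMap.congr_fun hM ⟨(Bᵀ * B).mulVecLin x, LinearMap.mem_range_self _ x⟩
  simp only [LinearMap.comp_apply, Submodule.subtype_apply] at this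
  refine Eq.trans ?_ this.symm
  have h2 : (Bᵀ * B).mulVecLin.quotKerEquivRange.symm
      ⟨(Bᵀ * B).mulVecLin x, LinearMap.mem_range_self (Bᵀ * B).mulVecLin x⟩
      = Submodule.Quotient.mk x := by
    rw [LinearEquiv.symm_apply_eq]; rfl
  rw [LinearEquiv.coe_coe, h2]
  rfl

/-- linear maps preserve coordinatewise big-O -/
lemma aux_linO {p q : ℕ} (M : (Fin p → ℝ) →ₗ[ℝ] (Fin q → ℝ)) (f : ℕ → Fin p → ℝ) (δ : ℕ → ℝ)
    (h : ∀ j, (fun k => f k j) =O[atTop] δ) (i : Fin q) : (fun k => M (f k) i) =O[atTop] δ := by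
  have : ∀ k, M (f k) i = ∑ j, f k j * M (Pi.single j 1) i := by
    intro k
    conv_lhs => rw [pi_eq_sum_univ' (f k)]
    simp only [map_sum, map_smul, Finset.sum_apply, Pi.smul_apply, smul_eq_mul]
  simp only [this]
  refine IsBigO.fun_sum fun j _ => ?_
  simpa [mul_comm] using (h j).const_mul_left (M (Pi.single j 1) i)

lemma aux_divO (f g δ : ℕ → ℝ) (a : ℝ) (ha : a ≠ 0) (hg : Tendsto g atTop (𝓝 a))
    (h : (fun k => g k * f k) =O[atTop] δ) : f =O[atTop] δ := by
  have h1 : (fun k => (g k)⁻¹ * (g k * f k)) =O[atTop] (fun k => (1 : ℝ) * δ k) :=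
    (hg.inv₀ ha).isBigO_one ℝ |>.mul h
  simp only [one_mul] at h1
  refine h1.congr' ?_ EventuallyEq.rfl
  filter_upwards [hg.eventually_ne ha] with k hk
  field_simp

lemma aux_mulO (f g δ : ℕ → ℝ) (a : ℝ) (hg : Tendsto g atTop (𝓝 a))
    (h : f =O[atTop] δ) : (fun k => g k * f k) =O[atTop] δ := by
  simpa using (hg.isBigO_one ℝ).mul h

/-- the final sequence argument -/
lemma aux_seq {E : Type*} [PseudoMetricSpace E] (f : ℕ → E) (a : E) (hf : Tendsto f atTop (𝓝 a))
    (G : ℕ → ℝ) (hG : ∀ k, 0 ≤ G k) (β : ℝ) (hβ : 0 < β)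
    (hdec : ∀ k, G (k + 1) + dist (f k) (f (k + 1)) ^ 2 / β ≤ G k)
    (hPL : ∃ C : ℝ, ∀ᶠ k in atTop, G (k + 1) ≤ C * dist (f k) (f (k + 1)) ^ 2) :
    ∃ c > 0, ∃ τ ∈ Set.Ioo (0 : ℝ) 1, ∃ k₀ : ℕ, ∀ k ≥ k₀, dist (f k) a ≤ c * τ ^ (k - k₀) := by
  obtain ⟨C, hC⟩ := hPL
  obtain ⟨k₀, hk₀⟩ := eventually_atTop.1 hC
  set K := β * (|C| + 1) with hK
  have hKpos : 0 < K := by positivity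
  set ρ := K / (1 + K) with hρ
  have hρ0 : 0 < ρ := by positivity
  have hρ1 : ρ < 1 := by rw [hρ, div_lt_one (by positivity)]; linarith
  have step : ∀ k ≥ k₀, G (k + 1) ≤ ρ * G k := by
    intro k hk
    have h1 := hk₀ k hk
    have h2 := hdec k
    set D := dist (f k) (f (k + 1)) ^ 2
    have hD : 0 ≤ D := by positivity
    have h3 : G (k + 1) ≤ (|C| + 1) * D := h1.trans (by nlinarith [le_abs_self C])
    have h4 : (|C| + 1) * D = K * (D / β) := by rw [hK]; field_simp
    have h5 : G (k + 1) ≤ K * (G k - G (k + 1)) := by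
      rw [h4] at h3
      exact h3.trans (mul_le_mul_of_nonneg_left (by linarith) hKpos.le)
    rw [hρ, div_mul_eq_mul_div, le_div_iff₀ (by positivity)]
    linarith
  have geo : ∀ i, G (k₀ + i) ≤ ρ ^ i * G k₀ := by
    intro i
    induction i with
    | zero => simp
    | succ i ih =>
      calc G (k₀ + i + 1) ≤ ρ * G (k₀ + i) := step _ (by omega)
        _ ≤ ρ * (ρ ^ i * G k₀) := mul_le_mul_of_nonneg_left ih hρ0.le
        _ = _ := by ring
  set τ := Real.sqrt ρ with hτ
  have hτ0 : 0 < τ := Real.sqrt_pos.2 hρ0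
  have hτ1 : τ < 1 := by
    rw [hτ, Real.sqrt_lt' one_pos]; simpa using hρ1
  set C1 := Real.sqrt (β * G k₀) with hC1
  have hd : ∀ i, dist (f (k₀ + i)) (f (k₀ + (i + 1))) ≤ C1 * τ ^ i := by
    intro i
    refine abs_le_of_sq_le_sq' ?_ (by positivity) |>.2
    have h1 : (C1 * τ ^ i) ^ 2 = β * (ρ ^ i * G k₀) := by
      rw [mul_pow, ← pow_mul, mul_comm i 2, pow_mul, hτ, Real.sq_sqrt hρ0.le, hC1,
        Real.sq_sqrt (mul_nonneg hβ.le (hG _))]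
      ring
    rw [h1]
    have h2 := hdec (k₀ + i)
    have h3 : dist (f (k₀ + i)) (f (k₀ + i + 1)) ^ 2 / β ≤ ρ ^ i * G k₀ := by
      linarith [hG (k₀ + i + 1), geo i]
    rw [div_le_iff₀ hβ] at h3
    rw [← add_assoc]; linarith
  have hf' : Tendsto (fun i => f (k₀ + i)) atTop (𝓝 a) := by
    have := (tendsto_add_atTop_iff_nat k₀).2 hf
    simpa [add_comm] using this
  refine ⟨C1 / (1 - τ) + 1, ?_, τ, ⟨hτ0, hτ1⟩, k₀, fun k hk => ?_⟩
  · have : 0 < 1 - τ := by linarith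
    positivity
  · obtain ⟨i, rfl⟩ := Nat.exists_eq_add_of_le hk
    have := dist_le_of_le_geometric_of_tendsto τ C1 hτ1 hd hf' i
    rw [Nat.add_sub_cancel_left]
    have h2 : C1 * τ ^ i / (1 - τ) = C1 / (1 - τ) * τ ^ i := by ring
    rw [h2] at this
    nlinarith [pow_pos hτ0 i]

lemma aux_norm {n : ℕ} (p : (Fin n → ℝ) × (Fin n → ℝ)) :
    pairl2norm p ≤ Real.sqrt (2 * n) * ‖p‖ := by
  unfold pairl2norm
  rw [← Real.sqrt_sq (norm_nonneg p), ← Real.sqrt_mul (by positivity)]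
  apply Real.sqrt_le_sqrt
  have h1 : ∀ i, p.1 i ^ 2 ≤ ‖p‖ ^ 2 := fun i => by
    rw [← sq_abs]
    exact pow_le_pow_left₀ (abs_nonneg _) ((norm_le_pi_norm p.1 i).trans (norm_fst_le p)) 2
  have h2 : ∀ i, p.2 i ^ 2 ≤ ‖p‖ ^ 2 := fun i => by
    rw [← sq_abs]
    exact pow_le_pow_left₀ (abs_nonneg _) ((norm_le_pi_norm p.2 i).trans (norm_snd_le p)) 2
  have h3 := Finset.sum_le_sum fun i (_ : i ∈ Finset.univ) => h1 i
  have h4 := Finset.sum_le_sum fun i (_ : i ∈ Finset.univ) => h2 i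
  simp at h3 h4
  linarith

lemma aux_norm' {n : ℕ} (p : (Fin n → ℝ) × (Fin n → ℝ)) :
    ‖p‖ ^ 2 ≤ (∑ i, p.1 i ^ 2) + ∑ i, p.2 i ^ 2 := by
  have key : ∀ x : Fin n → ℝ, ‖x‖ ≤ Real.sqrt (∑ i, x i ^ 2) := by
    intro x
    refine (pi_norm_le_iff_of_nonneg (Real.sqrt_nonneg _)).2 fun i => ?_
    rw [Real.norm_eq_abs]
    apply Real.abs_le_sqrt
    exact Finset.single_le_sum (f := fun i => x i ^ 2) (fun i _ => sq_nonneg _) (Finset.mem_univ i)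
  have s1 : 0 ≤ ∑ i, p.1 i ^ 2 := Finset.sum_nonneg fun i _ => sq_nonneg _
  have s2 : 0 ≤ ∑ i, p.2 i ^ 2 := Finset.sum_nonneg fun i _ => sq_nonneg _
  have : ‖p‖ ≤ Real.sqrt ((∑ i, p.1 i ^ 2) + ∑ i, p.2 i ^ 2) := by
    rw [Prod.norm_def]
    exact max_le ((key _).trans (Real.sqrt_le_sqrt (by linarith)))
      ((key _).trans (Real.sqrt_le_sqrt (by linarith)))
  calc ‖p‖ ^ 2 ≤ (Real.sqrt ((∑ i, p.1 i ^ 2) + ∑ i, p.2 i ^ 2)) ^ 2 :=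
        pow_le_pow_left₀ (norm_nonneg _) this 2
    _ = _ := Real.sq_sqrt (by linarith)

lemma aux_PL {m n : ℕ} (A : Matrix (Fin m) (Fin n) ℝ)
    (y : Fin m → ℝ) (T : Finset (Fin n))
    (lam α : ℝ) (hlam : 0 < lam) (hα : 0 < α)
    (u v : ℕ → (Fin n → ℝ))
    (hu : ∀ k : ℕ, ∀ u' : Fin n → ℝ,
      hppObj A y T lam (u (k + 1), v k) + (∑ i, (u (k + 1) i - u k i) ^ 2) / (2 * α)
        ≤ hppObj A y T lam (u', v k) + (∑ i, (u' i - u k i) ^ 2) / (2 * α))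
    (hv : ∀ k : ℕ, ∀ v' : Fin n → ℝ,
      hppObj A y T lam (u (k + 1), v (k + 1)) + (∑ i, (v (k + 1) i - v k i) ^ 2) / (2 * α)
        ≤ hppObj A y T lam (u (k + 1), v') + (∑ i, (v' i - v k i) ^ 2) / (2 * α))
    (us vs : Fin n → ℝ)
    (hconv : Tendsto (fun k => (u k, v k)) atTop (𝓝 (us, vs)))
    (zs : Fin n → ℝ) (hz : zs = fun j => us j * vs j)
    (γ : Fin n → ℝ) (hγ : γ = Aᵀ.mulVec (A.mulVec zs - y))
    (hTsupp : ∀ j ∈ T, zs j ≠ 0)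
    (hsc1 : ∀ j ∈ T, γ j = 0)
    (hsc2 : ∀ j ∈ Tᶜ, zs j ≠ 0 → γ j = -lam * Real.sign (zs j))
    (hsc3 : ∀ j ∈ Tᶜ, zs j = 0 → |γ j| < lam) :
    (fun k => hppObj A y T lam (u (k + 1), v (k + 1)) - hppObj A y T lam (us, vs))
      =O[atTop] (fun k => dist (u k, v k) (u (k + 1), v (k + 1)) ^ 2) := by
  set δ : ℕ → ℝ := fun k => dist (u k, v k) (u (k + 1), v (k + 1)) with hδ
  set e : ℕ → Fin n → ℝ := fun k j => u (k + 1) j * v (k + 1) j - zs j with he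
  set q : ℕ → Fin n → ℝ := fun k => Aᵀ.mulVec (A.mulVec (e k)) with hq
  -- convergence
  have tu0 : ∀ j, Tendsto (fun k => u k j) atTop (𝓝 (us j)) := fun j =>
    ((continuous_apply j).tendsto _).comp ((continuous_fst.tendsto _).comp hconv)
  have tv0 : ∀ j, Tendsto (fun k => v k j) atTop (𝓝 (vs j)) := fun j =>
    ((continuous_apply j).tendsto _).comp ((continuous_snd.tendsto _).comp hconv)
  have tu : ∀ j, Tendsto (fun k => u (k + 1) j) atTop (𝓝 (us j)) := fun j =>
    (tendsto_add_atTop_iff_nat (f := fun k => u k j) 1).2 (tu0 j)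
  have tv : ∀ j, Tendsto (fun k => v (k + 1) j) atTop (𝓝 (vs j)) := fun j =>
    (tendsto_add_atTop_iff_nat (f := fun k => v k j) 1).2 (tv0 j)
  have te : ∀ j, Tendsto (fun k => e k j) atTop (𝓝 0) := by
    intro j
    have := ((tu j).mul (tv j)).sub_const (zs j)
    simpa [he, hz] using this
  have tq : ∀ j, Tendsto (fun k => q k j) atTop (𝓝 0) := by
    intro j
    have h1 : Tendsto e atTop (𝓝 0) := tendsto_pi_nhds.2 te
    have h2 : Continuous (fun x : Fin n → ℝ => Aᵀ.mulVec (A.mulVec x) j) := by fun_prop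
    have := (h2.tendsto 0).comp h1
    simp only [Matrix.mulVec_zero, Pi.zero_apply] at this
    exact this
  have tδ : Tendsto δ atTop (𝓝 0) := by
    have := hconv.dist ((tendsto_add_atTop_iff_nat 1).2 hconv)
    simpa using this
  have du : ∀ j, (fun k => u (k + 1) j - u k j) =O[atTop] δ := fun j =>
    IsBigO.of_bound 1 (Eventually.of_forall fun k => by
      have h1 := norm_le_pi_norm (u (k + 1) - u k) j
      have h2 : ‖u (k + 1) - u k‖ ≤ δ k := by
        simp only [hδ, dist_eq_norm]
        rw [norm_sub_rev (u k, v k)]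
        exact norm_fst_le ((u (k + 1), v (k + 1)) - (u k, v k))
      rw [one_mul, Real.norm_of_nonneg (dist_nonneg : 0 ≤ δ k)]
      exact h1.trans h2)
  have dv : ∀ j, (fun k => v (k + 1) j - v k j) =O[atTop] δ := fun j =>
    IsBigO.of_bound 1 (Eventually.of_forall fun k => by
      have h1 := norm_le_pi_norm (v (k + 1) - v k) j
      have h2 : ‖v (k + 1) - v k‖ ≤ δ k := by
        simp only [hδ, dist_eq_norm]
        rw [norm_sub_rev (u k, v k)]
        exact norm_snd_le ((u (k + 1), v (k + 1)) - (u k, v k))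
      rw [one_mul, Real.norm_of_nonneg (dist_nonneg : 0 ≤ δ k)]
      exact h1.trans h2)
  -- stationarity
  have grad : ∀ k, Aᵀ.mulVec (A.mulVec (fun i => u (k + 1) i * v (k + 1) i) - y) = γ + q k := by
    intro k
    have h1 : (fun i => u (k + 1) i * v (k + 1) i) = zs + e k := by
      funext i; simp [he]
    rw [h1, hγ, hq, Matrix.mulVec_add]
    simp only [Matrix.mulVec_add, Matrix.mulVec_sub]
    abel
  set p : ℕ → Fin n → ℝ := fun k =>
    Aᵀ.mulVec (A.mulVec (fun i => u (k + 1) i * (v (k + 1) i - v k i))) with hp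
  have grad' : ∀ k, Aᵀ.mulVec (A.mulVec (fun i => u (k + 1) i * v k i) - y)
      = γ + q k - p k := by
    intro k
    have h1 : (fun i => u (k + 1) i * v k i) = (fun i => u (k + 1) i * v (k + 1) i)
        - (fun i => u (k + 1) i * (v (k + 1) i - v k i)) := by
      funext i; simp; ring
    rw [← grad, h1, hp]
    simp only [Matrix.mulVec_sub]
    abel
  have Op : ∀ j, (fun k => p k j) =O[atTop] δ := fun j =>
    aux_linO (Aᵀ.mulVecLin ∘ₗ A.mulVecLin) (fun k i => u (k + 1) i * (v (k + 1) i - v k i)) δ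
      (fun j => aux_mulO _ _ _ _ (tu j) (dv j)) j
  have Oa : ∀ j, (fun k => v (k + 1) j * (γ j + q k j)
      + (if j ∈ T then 0 else lam * u (k + 1) j)) =O[atTop] δ := by
    intro j
    have h1 : ∀ k, v (k + 1) j * (γ j + q k j) + (if j ∈ T then 0 else lam * u (k + 1) j)
        = (γ j + q k j) * (v (k + 1) j - v k j) + v k j * p k j
          - α⁻¹ * (u (k + 1) j - u k j) := by
      intro k
      have := hpp_stat A y T lam α hα (u (k + 1)) (v k) (u k) (hu k) j
      rw [grad'] at this
      simp only [Pi.add_apply, Pi.sub_apply] at this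
      rw [div_eq_inv_mul] at this
      linarith
    simp only [h1]
    exact ((aux_mulO _ _ _ _ ((tq j).const_add (γ j)) (dv j)).add
      (aux_mulO _ _ _ _ (tv0 j) (Op j))).sub ((du j).const_mul_left _)
  have Ob : ∀ j, (fun k => u (k + 1) j * (γ j + q k j)
      + (if j ∈ T then 0 else lam * v (k + 1) j)) =O[atTop] δ := by
    intro j
    have h1 : ∀ k, u (k + 1) j * (γ j + q k j) + (if j ∈ T then 0 else lam * v (k + 1) j)
        = (-α⁻¹) * (v (k + 1) j - v k j) := by
      intro k
      have := hpp_stat A y T lam α hα (v (k + 1)) (u (k + 1)) (v k) (fun v' => by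
        rw [hpp_comm A y T lam (v (k + 1)), hpp_comm A y T lam v']; exact hv k v') j
      have hc : (fun i => v (k + 1) i * u (k + 1) i) = fun i => u (k + 1) i * v (k + 1) i := by
        funext i; ring
      rw [hc, grad] at this
      simp only [Pi.add_apply] at this
      rw [div_eq_inv_mul] at this
      linarith
    simp only [h1]
    exact (dv j).const_mul_left _
  -- coordinates on the support
  have s_ne : ∀ j, zs j ≠ 0 → Real.sign (zs j) ^ 2 = 1 ∧ vs j + Real.sign (zs j) * us j ≠ 0 := by
    intro j hj
    have hjz : zs j = us j * vs j := by rw [hz]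
    have hv0 : vs j ≠ 0 := by intro h; apply hj; rw [hjz, h, mul_zero]
    have hv2 : 0 < vs j ^ 2 := by positivity
    rcases lt_or_gt_of_ne hj with h | h
    · rw [Real.sign_of_neg h]
      refine ⟨by norm_num, fun h0 => ?_⟩
      have : us j = vs j := by linarith
      rw [this] at hjz; nlinarith
    · rw [Real.sign_of_pos h]
      refine ⟨by norm_num, fun h0 => ?_⟩
      have : us j = -vs j := by linarith
      rw [this] at hjz; nlinarith
  have OqS : ∀ j, zs j ≠ 0 → (fun k => q k j) =O[atTop] δ := by
    intro j hj
    by_cases hjT : j ∈ T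
    · have h1 := Oa j
      simp only [hjT, if_true, hsc1 j hjT, zero_add, add_zero] at h1
      refine aux_divO _ _ _ (vs j) ?_ (tv j) h1
      intro h; apply hj; rw [hz]; simp [h]
    · have h1 := (Oa j).add ((Ob j).const_mul_left (Real.sign (zs j)))
      obtain ⟨hs, hne⟩ := s_ne j hj
      refine aux_divO _ _ _ _ hne ((tv j).add ((tu j).const_mul (Real.sign (zs j)))) ?_
      refine h1.congr_left fun k => ?_
      simp only [hjT, if_false, hsc2 j (by simpa using hjT) hj]
      linear_combination (-lam * u (k + 1) j) * hs
  have Ow : ∀ j, zs j ≠ 0 → j ∉ T →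
      (fun k => u (k + 1) j - Real.sign (zs j) * v (k + 1) j) =O[atTop] δ := by
    intro j hj hjT
    have h1 := ((Oa j).sub (aux_mulO _ _ _ _ (tv j) (OqS j hj))).const_mul_left lam⁻¹
    refine h1.congr_left fun k => ?_
    simp only [hjT, if_false, hsc2 j (by simpa using hjT) hj]
    field_simp
    ring
  have ws : ∀ j, zs j ≠ 0 → j ∉ T → us j - Real.sign (zs j) * vs j = 0 := fun j hj hjT =>
    tendsto_nhds_unique ((tu j).sub ((tv j).const_mul _)) ((Ow j hj hjT).trans_tendsto tδ)
  -- coordinates off the support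
  have nT : ∀ j, zs j = 0 → j ∉ T := fun j hj hjT => hTsupp j hjT hj
  have det : ∀ j, zs j = 0 → Tendsto (fun k => lam ^ 2 - (γ j + q k j) ^ 2) atTop
      (𝓝 (lam ^ 2 - (γ j + 0) ^ 2)) := fun j _ =>
    (((tq j).const_add (γ j)).pow 2).const_sub _
  have det0 : ∀ j, zs j = 0 → lam ^ 2 - (γ j + 0) ^ 2 ≠ 0 := by
    intro j hj
    have := hsc3 j (by simpa using nT j hj) hj
    have h2 : γ j ^ 2 < lam ^ 2 := by
      rw [← sq_abs (γ j)]; exact pow_lt_pow_left₀ this (abs_nonneg _) two_ne_zero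
    rw [add_zero]; linarith
  have Ou : ∀ j, zs j = 0 → (fun k => u (k + 1) j) =O[atTop] δ := by
    intro j hj
    refine aux_divO _ _ _ _ (det0 j hj) (det j hj) ?_
    have h1 := ((Oa j).const_mul_left lam).sub
      (aux_mulO _ _ _ _ ((tq j).const_add (γ j)) (Ob j))
    refine h1.congr_left fun k => ?_
    simp only [nT j hj, if_false]
    ring
  have Ov : ∀ j, zs j = 0 → (fun k => v (k + 1) j) =O[atTop] δ := by
    intro j hj
    refine aux_divO _ _ _ _ (det0 j hj) (det j hj) ?_
    have h1 := ((Ob j).const_mul_left lam).sub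
      (aux_mulO _ _ _ _ ((tq j).const_add (γ j)) (Oa j))
    refine h1.congr_left fun k => ?_
    simp only [nT j hj, if_false]
    ring
  have us0 : ∀ j, zs j = 0 → us j = 0 := fun j hj =>
    tendsto_nhds_unique (tu j) ((Ou j hj).trans_tendsto tδ)
  have vs0 : ∀ j, zs j = 0 → vs j = 0 := fun j hj =>
    tendsto_nhds_unique (tv j) ((Ov j hj).trans_tendsto tδ)
  -- the residual
  set e0 : ℕ → Fin n → ℝ := fun k j => if zs j = 0 then e k j else 0 with he0
  have Oe0 : ∀ j, (fun k => e0 k j) =O[atTop] δ := by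
    intro j
    by_cases hj : zs j = 0
    · simp only [he0, hj, if_true, he, sub_zero]
      exact aux_mulO _ _ _ _ (tu j) (Ov j hj)
    · simp only [he0, hj, if_false]
      exact isBigO_zero _ _
  set B : Matrix (Fin m) (Fin n) ℝ := fun i j => if zs j = 0 then 0 else A i j with hB
  have hBe : ∀ k, A.mulVec (e k) = B.mulVec (e k) + A.mulVec (e0 k) := by
    intro k
    funext i
    simp only [Matrix.mulVec, dotProduct, Pi.add_apply, ← Finset.sum_add_distrib]
    refine Finset.sum_congr rfl fun j _ => ?_
    by_cases hj : zs j = 0 <;> simp [hB, he0, hj]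
  have hBt : ∀ (x : Fin m → ℝ) j, Bᵀ.mulVec x j = if zs j = 0 then 0 else Aᵀ.mulVec x j := by
    intro x j
    by_cases hj : zs j = 0 <;> simp [hB, hj, Matrix.mulVec, dotProduct, Matrix.transpose]
  obtain ⟨M, hM⟩ := aux_gram B
  have Ogram : ∀ j, (fun k => (Bᵀ * B).mulVec (e k) j) =O[atTop] δ := by
    intro j
    have h1 : ∀ k, (Bᵀ * B).mulVec (e k) j
        = if zs j = 0 then 0 else q k j - Aᵀ.mulVec (A.mulVec (e0 k)) j := by
      intro k
      rw [← Matrix.mulVec_mulVec, hBt]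
      have : B.mulVec (e k) = A.mulVec (e k) - A.mulVec (e0 k) := by rw [hBe]; abel
      rw [this, Matrix.mulVec_sub]
      simp [hq]
    simp only [h1]
    by_cases hj : zs j = 0
    · simp only [hj, if_true]; exact isBigO_zero _ _
    · simp only [hj, if_false]
      exact (OqS j hj).sub (aux_linO (Aᵀ.mulVecLin ∘ₗ A.mulVecLin) e0 δ Oe0 j)
  have OAe : ∀ i, (fun k => A.mulVec (e k) i) =O[atTop] δ := by
    intro i
    have h1 := (aux_linO M (fun k => (Bᵀ * B).mulVec (e k)) δ Ogram i).add
      (aux_linO A.mulVecLin e0 δ Oe0 i)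
    refine h1.congr_left fun k => ?_
    rw [hBe, Pi.add_apply, hM]; simp
  -- the decomposition of the objective
  have dec : ∀ k, hppObj A y T lam (u (k + 1), v (k + 1)) - hppObj A y T lam (us, vs)
      = 2⁻¹ * (∑ i, A.mulVec (e k) i * A.mulVec (e k) i)
        + ∑ j, (γ j * e k j + if j ∈ T then 0 else
          lam / 2 * (u (k + 1) j ^ 2 + v (k + 1) j ^ 2 - us j ^ 2 - vs j ^ 2)) := by
    intro k
    have h1 : (fun i => u (k + 1) i * v (k + 1) i) = zs + e k := by
      funext i; simp [he]
    have h2 : ∑ j, γ j * e k j = ∑ i, (A.mulVec zs - y) i * A.mulVec (e k) i := by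
      have : γ ⬝ᵥ e k = (A.mulVec zs - y) ⬝ᵥ A.mulVec (e k) := by
        rw [hγ, Matrix.mulVec_transpose, Matrix.dotProduct_mulVec]
      exact this
    have h3 : ∑ i, (A.mulVec (zs + e k) i - y i) ^ 2 = ∑ i, (A.mulVec zs i - y i) ^ 2
        + 2 * ∑ i, (A.mulVec zs - y) i * A.mulVec (e k) i
        + ∑ i, A.mulVec (e k) i * A.mulVec (e k) i := by
      rw [Finset.mul_sum, ← Finset.sum_add_distrib, ← Finset.sum_add_distrib]
      refine Finset.sum_congr rfl fun i _ => ?_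
      rw [Matrix.mulVec_add]
      simp only [Pi.add_apply, Pi.sub_apply]
      ring
    have h4 : ∑ j, (if j ∈ T then 0 else
          lam / 2 * (u (k + 1) j ^ 2 + v (k + 1) j ^ 2 - us j ^ 2 - vs j ^ 2))
        = lam / 2 * (∑ j ∈ Tᶜ, u (k + 1) j ^ 2 + ∑ j ∈ Tᶜ, v (k + 1) j ^ 2
          - ∑ j ∈ Tᶜ, us j ^ 2 - ∑ j ∈ Tᶜ, vs j ^ 2) := by
      rw [← Finset.sum_add_distrib, ← Finset.sum_sub_distrib, ← Finset.sum_sub_distrib,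
        Finset.mul_sum, ← Finset.sum_filter_add_sum_filter_not Finset.univ (· ∈ T),
        Finset.sum_eq_zero, zero_add]
      · have : Finset.univ.filter (fun j => ¬ j ∈ T) = Tᶜ := by ext; simp
        rw [this]
        refine Finset.sum_congr rfl fun j hj => ?_
        rw [if_neg (by simpa using hj)]
      · intro j hj
        rw [if_pos (by simpa using hj)]
    rw [Finset.sum_add_distrib, h2, h4]
    simp only [hppObj]
    rw [h1, h3, ← hz]
    ring
  simp only [dec]
  have sqO : ∀ f g : ℕ → ℝ, f =O[atTop] δ → g =O[atTop] δ →
      (fun k => f k * g k) =O[atTop] (fun k => δ k ^ 2) := by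
    intro f g hf hg
    simpa [pow_two] using hf.mul hg
  refine IsBigO.add ((IsBigO.fun_sum fun i _ => sqO _ _ (OAe i) (OAe i)).const_mul_left _)
    (IsBigO.fun_sum fun j _ => ?_)
  by_cases hjT : j ∈ T
  · simp only [hsc1 j hjT, hjT, if_true, zero_mul, add_zero]; exact isBigO_zero _ _
  · by_cases hj : zs j = 0
    · have h1 := ((sqO _ _ (Ou j hj) (Ov j hj)).const_mul_left (γ j)).add
        (((sqO _ _ (Ou j hj) (Ou j hj)).add (sqO _ _ (Ov j hj) (Ov j hj))).const_mul_left (lam / 2))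
      refine h1.congr_left fun k => ?_
      simp only [he, hjT, if_false, hj, us0 j hj, vs0 j hj]
      ring
    · have h1 := (sqO _ _ (Ow j hj hjT) (Ow j hj hjT)).const_mul_left (lam / 2)
      refine h1.congr_left fun k => ?_
      obtain ⟨hs, _⟩ := s_ne j hj
      have hw := ws j hj hjT
      have hjz : e k j = u (k + 1) j * v (k + 1) j - us j * vs j := by simp [he, hz]
      rw [hjz, hsc2 j (by simpa using hjT) hj, if_neg hjT]
      generalize Real.sign (zs j) = s at *
      linear_combination (lam / 2 * (v (k + 1) j ^ 2 - vs j ^ 2)) * hs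
        + (lam / 2 * (us j - s * vs j)) * hw

end Aux

theorem stmt19 {m n : ℕ} (A : Matrix (Fin m) (Fin n) ℝ) (hrank : A.rank = m)
    (y : Fin m → ℝ) (T : Finset (Fin n)) (hT : T.card ≤ m)
    (lam α : ℝ) (hlam : 0 < lam) (hα : 0 < α)
    (u v : ℕ → (Fin n → ℝ))
    -- proximal alternating minimization iterates
    (hu : ∀ k : ℕ, ∀ u' : Fin n → ℝ,
      hppObj A y T lam (u (k + 1), v k) + (∑ i, (u (k + 1) i - u k i) ^ 2) / (2 * α)
        ≤ hppObj A y T lam (u', v k) + (∑ i, (u' i - u k i) ^ 2) / (2 * α))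
    (hv : ∀ k : ℕ, ∀ v' : Fin n → ℝ,
      hppObj A y T lam (u (k + 1), v (k + 1)) + (∑ i, (v (k + 1) i - v k i) ^ 2) / (2 * α)
        ≤ hppObj A y T lam (u (k + 1), v') + (∑ i, (v' i - v k i) ^ 2) / (2 * α))
    (ustar vstar : Fin n → ℝ)
    -- the iterates converge to `(u*, v*)`
    (hconv : Filter.Tendsto (fun k => (u k, v k)) Filter.atTop (nhds (ustar, vstar)))
    -- `(u*, v*)` is a global minimizer of `g`
    (hopt : ∀ p : (Fin n → ℝ) × (Fin n → ℝ),
      hppObj A y T lam (ustar, vstar) ≤ hppObj A y T lam p)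
    (zstar : Fin n → ℝ) (hz : zstar = fun j => ustar j * vstar j)
    (γ : Fin n → ℝ) (hγ : γ = Aᵀ.mulVec (A.mulVec zstar - y))
    -- `T ⊆ supp(z*)`
    (hTsupp : ∀ j ∈ T, zstar j ≠ 0)
    -- `z*` has at most `m` nonzero entries
    (hsp : Sparse m zstar)
    -- strict complementarity
    (hsc1 : ∀ j ∈ T, γ j = 0)
    (hsc2 : ∀ j ∈ Tᶜ, zstar j ≠ 0 → γ j = -lam * Real.sign (zstar j))
    (hsc3 : ∀ j ∈ Tᶜ, zstar j = 0 → |γ j| < lam) :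
    ∃ c > 0, ∃ τ ∈ Set.Ioo (0 : ℝ) 1, ∃ k₀ : ℕ, ∀ k ≥ k₀,
      pairl2norm (u k - ustar, v k - vstar) ≤ c * τ ^ (k - k₀) := by

  obtain ⟨c, hc, τ, hτ, k₀, h⟩ := aux_seq (fun k => (u k, v k)) (ustar, vstar) hconv
    (fun k => hppObj A y T lam (u k, v k) - hppObj A y T lam (ustar, vstar))
    (fun k => sub_nonneg.2 (hopt _)) (2 * α) (by positivity)
    (by
      intro k
      have h1 := hu k (u k)
      have h2 := hv k (v k)
      simp only [sub_self, ne_eq, OfNat.ofNat_ne_zero, not_false_eq_true, zero_pow,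
        Finset.sum_const_zero, zero_div, add_zero] at h1 h2
      have h3 := aux_norm' ((u (k + 1), v (k + 1)) - (u k, v k))
      simp only [Prod.fst_sub, Prod.snd_sub, Pi.sub_apply] at h3
      rw [dist_comm, dist_eq_norm]
      have h4 := div_le_div_of_nonneg_right h3 (by positivity : (0 : ℝ) ≤ 2 * α)
      rw [add_div] at h4
      linarith)
    (by
      obtain ⟨C, hC⟩ := (aux_PL A y T lam α hlam hα u v hu hv ustar vstar hconv zstar hz γ hγ
        hTsupp hsc1 hsc2 hsc3).bound
      refine ⟨C, hC.mono fun k hk => ?_⟩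
      rw [Real.norm_of_nonneg (by positivity : (0:ℝ) ≤
        dist (u k, v k) (u (k + 1), v (k + 1)) ^ 2)] at hk
      exact (le_abs_self _).trans hk)
  refine ⟨(Real.sqrt (2 * n) + 1) * c, by positivity, τ, hτ, k₀, fun k hk => ?_⟩
  have h1 := aux_norm (u k - ustar, v k - vstar)
  have h2 := h k hk
  simp only [dist_eq_norm, Prod.mk_sub_mk] at h2
  have h3 : 0 ≤ Real.sqrt (2 * n) := Real.sqrt_nonneg _
  calc _ ≤ _ := h1
    _ ≤ (Real.sqrt (2 * n) + 1) * (c * τ ^ (k - k₀)) := by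
      apply mul_le_mul (by linarith) h2 (norm_nonneg _) (by linarith)
    _ = _ := by ring
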